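/- arXiv:1509.02646 — 3 statements merged into one kernel-verified Lean document; each statement's English description precedes it below -/
import Mathlib

section
/- The improper integral ∫₀¹ (π²/4 − E(t)²)/(t·E(t)²) dt converges and equals ln(4/e) = 2·ln 2 − 1. -/
open MeasureTheory

/-- Complete Legendre elliptic integral of the second kind. -/
noncomputable def ellE (k : ℝ) : ℝ :=
  ∫ t in (0:ℝ)..1, Real.sqrt ((1 - k^2 * t^2) / (1 - t^2))

/-- Complete Legendre elliptic integral of the first kind. -/
noncomputable def ellK (k : ℝ) : ℝ :=
  ∫ t in (0:ℝ)..1, 1 / Real.sqrt ((1 - t^2) * (1 - k^2 * t^2))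

/-- The function `Ψ(k) = k / E(k)`. -/
noncomputable def PsiFn (k : ℝ) : ℝ := k / ellE k

/-- `Φ`, the inverse on `[0,1]` of the strictly increasing bijection `Ψ`. -/
noncomputable def PhiFn (x : ℝ) : ℝ :=
  sSup {y : ℝ | y ∈ Set.Icc (0:ℝ) 1 ∧ PsiFn y ≤ x}

/-- The function `𝒥(x) = (π²/4) ∫_{Φ(2x/π)}^1 dt/(t E(t)²)`. -/
noncomputable def Jcal (x : ℝ) : ℝ :=
  (Real.pi^2 / 4) * ∫ t in PhiFn (2*x/Real.pi)..(1:ℝ), 1 / (t * (ellE t)^2)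

/-- The function `𝒥_l(c) = (π/2) ∫_c^{πl/2} dτ/(Φ(2τ/(πl)) K(Φ(2τ/(πl))))`. -/
noncomputable def Jl (l c : ℝ) : ℝ :=
  (Real.pi / 2) * ∫ τ in c..(Real.pi * l / 2),
    1 / (PhiFn (2*τ/(Real.pi*l)) * ellK (PhiFn (2*τ/(Real.pi*l))))

/-- The approximation `λ̃_n(c)`. -/
noncomputable def lambdaTilde (n : ℕ) (c : ℝ) : ℝ :=
  (1/2) * Real.exp (-(Real.pi^2 * ((n:ℝ) + 1/2) / 2) *
    ∫ t in PhiFn (2*c/(Real.pi*((n:ℝ)+1/2)))..(1:ℝ), 1 / (t * (ellE t)^2))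

/-- The kernel `sin(c(x-y))/(π(x-y))`, with value `c/π` on the diagonal. -/
noncomputable def sincKernel (c x y : ℝ) : ℝ :=
  if x = y then c / Real.pi else Real.sin (c*(x-y)) / (Real.pi * (x-y))

/-- The quadratic form `⟨Q_c f, f⟩` of the time-and-frequency limiting operator `Q_c`. -/
noncomputable def QForm (c : ℝ) (f : ℝ → ℝ) : ℝ :=
  ∫ x in Set.Ioo (-1:ℝ) 1, ∫ y in Set.Ioo (-1:ℝ) 1, sincKernel c x y * f y * f x

/-- The `(n+1)`-st eigenvalue `λ_n(c)` of `Q_c`, via the Courant–Fischer min-max principle. -/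
noncomputable def lambda (n : ℕ) (c : ℝ) : ℝ :=
  ⨆ V : {V : Submodule ℝ (Lp ℝ 2 (volume.restrict (Set.Ioo (-1:ℝ) 1))) //
          Module.finrank ℝ V = n + 1},
    ⨅ f : {f : Lp ℝ 2 (volume.restrict (Set.Ioo (-1:ℝ) 1)) // f ∈ V.1 ∧ f ≠ 0},
      QForm c (f.1 : ℝ → ℝ) / ‖f.1‖^2


open Real Set Filter Topology

/-- The integral `∫ (1 - m sin² θ)^p dθ` over `[0, π/2]`, which for `p = 1/2` and `p = -1/2` is the
complete elliptic integral of the second and first kind with parameter `m`. -/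
noncomputable def legendreIntegral (p m : ℝ) : ℝ :=
  ∫ θ in (0:ℝ)..(π / 2), (1 - m * sin θ ^ 2) ^ p

lemma one_sub_mul_sin_sq_ge {b m : ℝ} (hm : m ≤ b) (θ : ℝ) :
    min 1 (1 - b) ≤ 1 - m * sin θ ^ 2 := by
  have h0 := sq_nonneg (sin θ)
  have h1 := sin_sq_le_one θ
  rcases le_total 0 m with h | h
  · exact (min_le_right _ _).trans (by nlinarith)
  · exact (min_le_left _ _).trans (by nlinarith)

lemma one_sub_mul_sin_sq_pos {m : ℝ} (hm : m < 1) (θ : ℝ) : 0 < 1 - m * sin θ ^ 2 :=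
  lt_of_lt_of_le (lt_min one_pos (by linarith)) (one_sub_mul_sin_sq_ge le_rfl θ)

lemma continuous_one_sub_mul_sin_sq_rpow {m : ℝ} (hm : m < 1) (p : ℝ) :
    Continuous fun θ ↦ (1 - m * sin θ ^ 2) ^ p :=
  Continuous.rpow_const (by fun_prop) fun θ ↦ Or.inl (one_sub_mul_sin_sq_pos hm θ).ne'

lemma rpow_le_add_rpow {l u x : ℝ} (q : ℝ) (hl : 0 < l) (hlx : l ≤ x) (hxu : x ≤ u) :
    x ^ q ≤ l ^ q + u ^ q := by
  have hx : 0 < x := hl.trans_le hlx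
  have hu : 0 < u := hx.trans_le hxu
  rcases le_total 0 q with h | h
  · have := rpow_le_rpow hx.le hxu h
    have := rpow_nonneg hl.le q
    linarith
  · have := rpow_le_rpow_of_nonpos hl hlx h
    have := rpow_nonneg hu.le q
    linarith

lemma hasDerivAt_legendreIntegral (p : ℝ) {m : ℝ} (hm : m < 1) :
    HasDerivAt (legendreIntegral p)
      (∫ θ in (0:ℝ)..(π / 2), -(sin θ ^ 2) * p * (1 - m * sin θ ^ 2) ^ (p - 1)) m := by
  obtain ⟨b, hmb, hb⟩ := exists_between hm
  refine (intervalIntegral.hasDerivAt_integral_of_dominated_loc_of_deriv_le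
    (μ := volume) (a := 0) (b := π / 2)
    (F' := fun m θ ↦ -(sin θ ^ 2) * p * (1 - m * sin θ ^ 2) ^ (p - 1))
    (F := fun m θ ↦ (1 - m * sin θ ^ 2) ^ p)
    (s := Ioo (m - 1) b) (bound := fun _ ↦
      |p| * (min 1 (1 - b) ^ (p - 1) + (2 + |m|) ^ (p - 1)))
    (Ioo_mem_nhds (by linarith) hmb) ?_ ?_ ?_ ?_ ?_ ?_).2
  · filter_upwards [Iio_mem_nhds hm] with x hx
    exact (continuous_one_sub_mul_sin_sq_rpow hx p).aestronglyMeasurable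
  · exact (continuous_one_sub_mul_sin_sq_rpow hm p).intervalIntegrable _ _
  · exact (Continuous.mul (by fun_prop)
      (continuous_one_sub_mul_sin_sq_rpow hm (p - 1))).aestronglyMeasurable
  · refine Eventually.of_forall fun θ _ x hx ↦ ?_
    have hx1 : x < 1 := hx.2.trans hb
    have hpos := one_sub_mul_sin_sq_pos hx1 θ
    have hle : 1 - x * sin θ ^ 2 ≤ 2 + |m| := by
      have h0 := sq_nonneg (sin θ)
      have h1 := sin_sq_le_one θ
      have h2 := neg_abs_le m
      have h3 := abs_nonneg m
      have h4 : -(1 + |m|) ≤ x := by linarith [hx.1]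
      nlinarith
    have hq := rpow_le_add_rpow (p - 1) (lt_min one_pos (by linarith))
      (one_sub_mul_sin_sq_ge hx.2.le θ) hle
    rw [norm_mul, norm_mul, norm_neg, Real.norm_eq_abs, Real.norm_eq_abs, Real.norm_eq_abs,
      abs_of_nonneg (sq_nonneg (sin θ)), abs_of_pos (rpow_pos_of_pos hpos _)]
    calc sin θ ^ 2 * |p| * (1 - x * sin θ ^ 2) ^ (p - 1)
        ≤ 1 * |p| * (1 - x * sin θ ^ 2) ^ (p - 1) := by
          gcongr
          exact sin_sq_le_one θ
      _ ≤ _ := by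
          rw [one_mul]
          gcongr
  · exact intervalIntegrable_const
  · refine Eventually.of_forall fun θ _ x hx ↦ ?_
    have hx1 : x < 1 := hx.2.trans hb
    refine HasDerivAt.rpow_const ?_ (Or.inl (one_sub_mul_sin_sq_pos hx1 θ).ne')
    simpa using ((hasDerivAt_id x).mul_const (sin θ ^ 2)).const_sub 1

lemma hasDerivAt_legendreIntegral' (p : ℝ) {m : ℝ} (hm0 : m ≠ 0) (hm : m < 1) :
    HasDerivAt (legendreIntegral p)
      (p / m * (legendreIntegral p m - legendreIntegral (p - 1) m)) m := by
  convert hasDerivAt_legendreIntegral p hm using 1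
  rw [legendreIntegral, legendreIntegral, ← intervalIntegral.integral_sub
    ((continuous_one_sub_mul_sin_sq_rpow hm _).intervalIntegrable _ _)
    ((continuous_one_sub_mul_sin_sq_rpow hm _).intervalIntegrable _ _),
    ← intervalIntegral.integral_const_mul]
  refine intervalIntegral.integral_congr fun θ _ ↦ ?_
  have hpos := one_sub_mul_sin_sq_pos hm θ
  have h : (1 - m * sin θ ^ 2) ^ p = (1 - m * sin θ ^ 2) ^ (p - 1) * (1 - m * sin θ ^ 2) := by
    rw [← rpow_add_one hpos.ne']
    simp
  simp only [h]
  field_simp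
  ring

lemma continuousAt_legendreIntegral (p : ℝ) {m : ℝ} (hm : m < 1) :
    ContinuousAt (legendreIntegral p) m :=
  (hasDerivAt_legendreIntegral p hm).continuousAt

lemma continuous_legendreIntegral {p : ℝ} (hp : 0 ≤ p) : Continuous (legendreIntegral p) := by
  refine intervalIntegral.continuous_parametric_intervalIntegral_of_continuous' ?_ _ _
  exact Continuous.rpow_const (by fun_prop) fun _ ↦ Or.inr hp

lemma legendreIntegral_zero (p : ℝ) : legendreIntegral p 0 = π / 2 := by
  simp [legendreIntegral]

lemma legendreIntegral_half_one : legendreIntegral (1 / 2) 1 = 1 := by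
  have : legendreIntegral (1 / 2) 1 = ∫ θ in (0:ℝ)..(π / 2), cos θ := by
    refine intervalIntegral.integral_congr fun θ hθ ↦ ?_
    rw [uIcc_of_le (by positivity)] at hθ
    have hc : 0 ≤ cos θ := cos_nonneg_of_mem_Icc ⟨by linarith [hθ.1, pi_pos], hθ.2⟩
    have h : 1 - 1 * sin θ ^ 2 = cos θ ^ 2 := by rw [cos_sq']; ring
    simp only [h, ← sqrt_eq_rpow, sqrt_sq hc]
  rw [this, integral_cos, sin_pi_div_two, sin_zero, sub_zero]

lemma legendreIntegral_neg_three_halves {m : ℝ} (hm : m < 1) :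
    (1 - m) * legendreIntegral (-3 / 2) m = legendreIntegral (1 / 2) m := by
  have h_int : ∀ q : ℝ, IntervalIntegrable (fun θ ↦ (1 - m * sin θ ^ 2) ^ q) volume 0 (π / 2) :=
    fun q ↦ (continuous_one_sub_mul_sin_sq_rpow hm q).intervalIntegrable _ _
  have key : ∫ θ in (0:ℝ)..(π / 2), ((1 - m * sin θ ^ 2) ^ (1 / 2 : ℝ)
      - (1 - m) * (1 - m * sin θ ^ 2) ^ (-3 / 2 : ℝ)) = 0 := by
    have h := intervalIntegral.integral_eq_sub_of_hasDerivAt (a := 0) (b := π / 2)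
      (f := fun θ ↦ m * (sin θ * cos θ * (1 - m * sin θ ^ 2) ^ (-1 / 2 : ℝ)))
      (f' := fun θ ↦ (1 - m * sin θ ^ 2) ^ (1 / 2 : ℝ)
        - (1 - m) * (1 - m * sin θ ^ 2) ^ (-3 / 2 : ℝ)) ?_ ((h_int _).sub ((h_int _).const_mul _))
    · simpa using h
    · intro θ _
      have hpos := one_sub_mul_sin_sq_pos hm θ
      have hX : HasDerivAt (fun θ ↦ 1 - m * sin θ ^ 2) (-(m * (2 * sin θ * cos θ))) θ := by
        simpa using (((hasDerivAt_sin θ).pow 2).const_mul m).const_sub 1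
      have h1 : (1 - m * sin θ ^ 2) ^ (1 / 2 : ℝ)
          = (1 - m * sin θ ^ 2) ^ (-3 / 2 : ℝ) * (1 - m * sin θ ^ 2) ^ 2 := by
        rw [← rpow_natCast (1 - m * sin θ ^ 2) 2, ← rpow_add hpos]; norm_num
      have h2 : (1 - m * sin θ ^ 2) ^ (-1 / 2 : ℝ)
          = (1 - m * sin θ ^ 2) ^ (-3 / 2 : ℝ) * (1 - m * sin θ ^ 2) := by
        rw [← rpow_add_one hpos.ne']; norm_num
      have h3 : (-1 / 2 - 1 : ℝ) = -3 / 2 := by norm_num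
      refine ((((hasDerivAt_sin θ).mul (hasDerivAt_cos θ)).mul
        (hX.rpow_const (p := -1 / 2) (Or.inl hpos.ne'))).const_mul m).congr_deriv ?_
      simp only [Pi.mul_apply, h3, h1, h2]
      have hc : cos θ ^ 2 = 1 - sin θ ^ 2 := cos_sq' θ
      linear_combination m * (1 - m * sin θ ^ 2) ^ (-3 / 2 : ℝ) * hc
  rw [intervalIntegral.integral_sub (h_int _) ((h_int _).const_mul _),
    intervalIntegral.integral_const_mul] at key
  rw [legendreIntegral, legendreIntegral]
  linarith

lemma one_sub_mul_cos_sq_pos {m : ℝ} (hm : 0 < m) (θ : ℝ) : 0 < 1 - (1 - m) * cos θ ^ 2 := by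
  have h := one_sub_mul_sin_sq_pos (sub_lt_self 1 hm) (π / 2 - θ)
  rwa [sin_pi_div_two_sub] at h

lemma continuous_one_sub_mul_cos_sq_rpow {m : ℝ} (hm : 0 < m) (p : ℝ) :
    Continuous fun θ ↦ (1 - (1 - m) * cos θ ^ 2) ^ p :=
  Continuous.rpow_const (by fun_prop) fun θ ↦ Or.inl (one_sub_mul_cos_sq_pos hm θ).ne'

lemma legendreIntegral_one_sub (p m : ℝ) :
    legendreIntegral p (1 - m) = ∫ θ in (0:ℝ)..(π / 2), (1 - (1 - m) * cos θ ^ 2) ^ p := by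
  have h := intervalIntegral.integral_comp_sub_left (a := 0) (b := π / 2)
    (fun θ ↦ (1 - (1 - m) * sin θ ^ 2) ^ p) (π / 2)
  simp only [sin_pi_div_two_sub, sub_self, sub_zero] at h
  rw [legendreIntegral, h]

lemma integral_cos_mul_rpow_neg_half {m : ℝ} (hm0 : 0 < m) (hm1 : m < 1) :
    ∫ θ in (0:ℝ)..(π / 2), cos θ * (1 - (1 - m) * cos θ ^ 2) ^ (-1 / 2 : ℝ) =
      arsinh (√(1 - m) / √m) / √(1 - m) := by
  have hu : 0 < √(1 - m) := sqrt_pos.2 (by linarith)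
  have hv : 0 < √m := sqrt_pos.2 hm0
  have hu2 : √(1 - m) ^ 2 = 1 - m := sq_sqrt (by linarith)
  have hv2 : √m ^ 2 = m := sq_sqrt hm0.le
  rw [intervalIntegral.integral_eq_sub_of_hasDerivAt
    (f := fun θ ↦ arsinh (√(1 - m) / √m * sin θ) / √(1 - m))]
  · simp
  · intro θ _
    refine ((((hasDerivAt_sin θ).const_mul _).arsinh).div_const _).congr_deriv ?_
    have hpos := one_sub_mul_cos_sq_pos hm0 θ
    have h1 : 1 + (√(1 - m) / √m * sin θ) ^ 2 = (1 - (1 - m) * cos θ ^ 2) / √m ^ 2 := by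
      rw [mul_pow, div_pow, hu2, hv2, cos_sq']
      field_simp
      ring
    rw [h1, sqrt_div hpos.le, sqrt_sq hv.le, neg_div, rpow_neg hpos.le, ← sqrt_eq_rpow,
      smul_eq_mul]
    have := sqrt_pos.2 hpos
    field_simp
  · exact (continuous_cos.mul (continuous_one_sub_mul_cos_sq_rpow hm0 _)).intervalIntegrable _ _

lemma tendsto_integral_one_sub_cos_mul_rpow :
    Tendsto (fun m ↦ ∫ θ in (0:ℝ)..(π / 2),
      (1 - cos θ) * (1 - (1 - m) * cos θ ^ 2) ^ (-1 / 2 : ℝ)) (𝓝[>] 0) (𝓝 (log 2)) := by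
  have hcos : ∀ θ ∈ uIcc (0:ℝ) (π / 2), 0 ≤ cos θ := fun θ hθ ↦ by
    rw [uIcc_of_le (by positivity)] at hθ
    exact cos_nonneg_of_mem_Icc ⟨by linarith [hθ.1, pi_pos], hθ.2⟩
  have hlim : ∫ θ in (0:ℝ)..(π / 2), sin θ / (1 + cos θ) = log 2 := by
    rw [intervalIntegral.integral_eq_sub_of_hasDerivAt (f := fun θ ↦ -log (1 + cos θ))]
    · norm_num
    · intro θ hθ
      have := hcos θ hθ
      refine ((((hasDerivAt_cos θ).const_add 1).log (by positivity)).neg).congr_deriv ?_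
      ring
    · refine ContinuousOn.intervalIntegrable fun θ hθ ↦ ?_
      have := hcos θ hθ
      exact (ContinuousAt.div (by fun_prop) (by fun_prop) (by positivity)).continuousWithinAt
  rw [← hlim]
  have hpt : ∀ θ ∈ uIoc (0:ℝ) (π / 2), 0 < sin θ ∧ 0 ≤ cos θ ∧ sin θ / (1 + cos θ) ≤ 1 ∧
      (1 - cos θ) * (sin θ ^ 2) ^ (-1 / 2 : ℝ) = sin θ / (1 + cos θ) := by
    intro θ hθ
    have hc := hcos θ (uIoc_subset_uIcc hθ)
    rw [uIoc_of_le (by positivity)] at hθ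
    have hs : 0 < sin θ := sin_pos_of_pos_of_lt_pi hθ.1 (by linarith [hθ.2, pi_pos])
    refine ⟨hs, hc, ?_, ?_⟩
    · rw [div_le_one (by positivity)]
      linarith [sin_le_one θ]
    · rw [neg_div, rpow_neg (by positivity), ← sqrt_eq_rpow, sqrt_sq hs.le]
      field_simp
      linarith [sin_sq_add_cos_sq θ]
  refine intervalIntegral.tendsto_integral_filter_of_dominated_convergence (fun _ ↦ 1) ?_ ?_ ?_ ?_
  · filter_upwards [self_mem_nhdsWithin] with m hm
    exact (Continuous.mul (by fun_prop)
      (continuous_one_sub_mul_cos_sq_rpow hm _)).aestronglyMeasurable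
  · filter_upwards [self_mem_nhdsWithin] with m (hm : 0 < m)
    refine Eventually.of_forall fun θ hθ ↦ ?_
    obtain ⟨hs, hc, hle, heq⟩ := hpt θ hθ
    have h1 : 0 ≤ 1 - cos θ := sub_nonneg.2 (cos_le_one θ)
    have hpos := one_sub_mul_cos_sq_pos hm θ
    rw [Real.norm_eq_abs, abs_of_nonneg (by positivity)]
    refine le_trans ?_ (heq.trans_le hle)
    refine mul_le_mul_of_nonneg_left (rpow_le_rpow_of_nonpos (by positivity) ?_ (by norm_num)) h1
    rw [sin_sq]
    nlinarith [mul_nonneg hm.le (sq_nonneg (cos θ))]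
  · exact intervalIntegrable_const
  · refine Eventually.of_forall fun θ hθ ↦ ?_
    obtain ⟨hs, hc, hle, heq⟩ := hpt θ hθ
    rw [← heq]
    refine tendsto_nhdsWithin_of_tendsto_nhds (Tendsto.const_mul _ ?_)
    have h0 : 1 - (1 - 0) * cos θ ^ 2 = sin θ ^ 2 := by rw [sin_sq]; ring
    rw [← h0]
    have hcont : Continuous fun m : ℝ ↦ 1 - (1 - m) * cos θ ^ 2 := by fun_prop
    exact (hcont.tendsto 0).rpow_const (Or.inl (by rw [h0]; positivity))

lemma tendsto_mul_log_nhdsGT_zero : Tendsto (fun m : ℝ ↦ m * log m) (𝓝[>] 0) (𝓝 0) := by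
  simpa using tendsto_nhdsWithin_of_tendsto_nhds (continuous_mul_log.tendsto 0)

lemma tendsto_legendreIntegral_neg_half_add_log :
    Tendsto (fun m ↦ legendreIntegral (-1 / 2) (1 - m) + log m / 2) (𝓝[>] 0)
      (𝓝 (2 * log 2)) := by
  have hu : Tendsto (fun m : ℝ ↦ √(1 - m)) (𝓝[>] 0) (𝓝 1) := by
    have : Continuous fun m : ℝ ↦ √(1 - m) := by fun_prop
    simpa using tendsto_nhdsWithin_of_tendsto_nhds (this.tendsto 0)
  have hu1 : Tendsto (fun m : ℝ ↦ 1 + √(1 - m)) (𝓝[>] 0) (𝓝 2) := by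
    convert hu.const_add 1 using 2
    norm_num
  have hmain := (tendsto_integral_one_sub_cos_mul_rpow.add
    ((hu1.log two_ne_zero).div hu one_ne_zero)).sub
    (tendsto_mul_log_nhdsGT_zero.div ((hu.mul hu1).const_mul 2) (by norm_num))
  have hval : log 2 + log 2 / 1 - 0 / (2 * (1 * 2)) = 2 * log 2 := by ring
  rw [hval] at hmain
  refine hmain.congr' ?_
  filter_upwards [Ioo_mem_nhdsGT zero_lt_one] with m ⟨hm0, hm1⟩
  have hupos : 0 < √(1 - m) := sqrt_pos.2 (by linarith)
  have hv : 0 < √m := sqrt_pos.2 hm0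
  have hu2 : √(1 - m) ^ 2 = 1 - m := sq_sqrt (by linarith)
  have hv2 : √m ^ 2 = m := sq_sqrt hm0.le
  have hsplit : legendreIntegral (-1 / 2) (1 - m) =
      (∫ θ in (0:ℝ)..(π / 2), (1 - cos θ) * (1 - (1 - m) * cos θ ^ 2) ^ (-1 / 2 : ℝ)) +
        arsinh (√(1 - m) / √m) / √(1 - m) := by
    rw [legendreIntegral_one_sub, ← integral_cos_mul_rpow_neg_half hm0 hm1,
      ← intervalIntegral.integral_add
        (f := fun θ ↦ (1 - cos θ) * (1 - (1 - m) * cos θ ^ 2) ^ (-1 / 2 : ℝ))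
        (g := fun θ ↦ cos θ * (1 - (1 - m) * cos θ ^ 2) ^ (-1 / 2 : ℝ))
        (((continuous_const.sub continuous_cos).mul
          (continuous_one_sub_mul_cos_sq_rpow hm0 _)).intervalIntegrable _ _)
        ((continuous_cos.mul (continuous_one_sub_mul_cos_sq_rpow hm0 _)).intervalIntegrable _ _)]
    congr 1
    ext θ
    ring
  have harsinh : arsinh (√(1 - m) / √m) = log (1 + √(1 - m)) - log m / 2 := by
    have h1 : 1 + (√(1 - m) / √m) ^ 2 = 1 / √m ^ 2 := by
      rw [div_pow, hu2, hv2]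
      field_simp
      ring
    rw [arsinh, h1, sqrt_div zero_le_one, sqrt_one, sqrt_sq hv.le, ← add_div,
      log_div (by positivity) hv.ne', log_sqrt hm0.le, add_comm]
  rw [hsplit, harsinh]
  simp only [Pi.div_apply]
  generalize (∫ θ in (0:ℝ)..(π / 2),
    (1 - cos θ) * (1 - (1 - m) * cos θ ^ 2) ^ (-1 / 2 : ℝ)) = G
  field_simp
  linear_combination -log m * hu2

lemma hasDerivAt_legendreIntegral_half {m : ℝ} (hm0 : 0 < m) (hm1 : m < 1) :
    HasDerivAt (legendreIntegral (1 / 2))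
      ((legendreIntegral (1 / 2) m - legendreIntegral (-1 / 2) m) / (2 * m)) m := by
  have h := hasDerivAt_legendreIntegral' (1 / 2) hm0.ne' hm1
  rw [show (1 / 2 - 1 : ℝ) = -1 / 2 by norm_num] at h
  refine h.congr_deriv ?_
  field_simp

lemma hasDerivAt_legendreIntegral_neg_half {m : ℝ} (hm0 : 0 < m) (hm1 : m < 1) :
    HasDerivAt (legendreIntegral (-1 / 2))
      ((legendreIntegral (1 / 2) m / (1 - m) - legendreIntegral (-1 / 2) m) / (2 * m)) m := by
  have h := hasDerivAt_legendreIntegral' (-1 / 2) hm0.ne' hm1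
  rw [show (-1 / 2 - 1 : ℝ) = -3 / 2 by norm_num] at h
  refine h.congr_deriv ?_
  have h1 : 1 - m ≠ 0 := by linarith
  rw [← legendreIntegral_neg_three_halves hm1]
  field_simp
  ring

lemma hasDerivAt_legendreIntegral_half_one_sub {m : ℝ} (hm0 : 0 < m) (hm1 : m < 1) :
    HasDerivAt (fun m ↦ legendreIntegral (1 / 2) (1 - m))
      (-((legendreIntegral (1 / 2) (1 - m) - legendreIntegral (-1 / 2) (1 - m)) / (2 * (1 - m))))
      m := by
  exact (hasDerivAt_legendreIntegral_half (sub_pos.2 hm1) (sub_lt_self 1 hm0)).comp_const_sub 1 m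

lemma hasDerivAt_legendreIntegral_neg_half_one_sub {m : ℝ} (hm0 : 0 < m) (hm1 : m < 1) :
    HasDerivAt (fun m ↦ legendreIntegral (-1 / 2) (1 - m))
      (-((legendreIntegral (1 / 2) (1 - m) / m - legendreIntegral (-1 / 2) (1 - m)) /
        (2 * (1 - m)))) m := by
  have h := (hasDerivAt_legendreIntegral_neg_half (sub_pos.2 hm1)
    (sub_lt_self 1 hm0)).comp_const_sub 1 m
  rwa [sub_sub_cancel] at h

lemma exists_tendsto_legendreIntegral_slope (p : ℝ) :
    ∃ c, Tendsto (fun m ↦ (legendreIntegral p m - π / 2) / m) (𝓝[>] 0) (𝓝 c) := by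
  refine ⟨_, ((hasDerivAt_iff_tendsto_slope_zero.1
    (hasDerivAt_legendreIntegral p one_pos)).mono_left
      (nhdsWithin_mono _ fun x (hx : 0 < x) ↦ hx.ne')).congr fun m ↦ ?_⟩
  rw [zero_add, legendreIntegral_zero, smul_eq_mul, inv_mul_eq_div]

lemma tendsto_legendreIntegral_nhdsGT_zero (p : ℝ) :
    Tendsto (legendreIntegral p) (𝓝[>] 0) (𝓝 (π / 2)) := by
  simpa [legendreIntegral_zero] using tendsto_nhdsWithin_of_tendsto_nhds
    (continuousAt_legendreIntegral p one_pos).tendsto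

lemma tendsto_legendreIntegral_half_one_sub :
    Tendsto (fun m ↦ legendreIntegral (1 / 2) (1 - m)) (𝓝[>] 0) (𝓝 1) := by
  have h : Continuous fun m : ℝ ↦ legendreIntegral (1 / 2) (1 - m) :=
    (continuous_legendreIntegral (by norm_num)).comp (by fun_prop)
  have h0 := tendsto_nhdsWithin_of_tendsto_nhds (s := Ioi 0) (h.tendsto 0)
  rwa [sub_zero, legendreIntegral_half_one] at h0

/-- Legendre's relation between complementary complete elliptic integrals. -/
theorem legendre_relation {m : ℝ} (hm0 : 0 < m) (hm1 : m < 1) :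
    legendreIntegral (-1 / 2) (1 - m) * legendreIntegral (1 / 2) m +
      legendreIntegral (1 / 2) (1 - m) * legendreIntegral (-1 / 2) m -
      legendreIntegral (-1 / 2) (1 - m) * legendreIntegral (-1 / 2) m = π / 2 := by
  set W : ℝ → ℝ := fun m ↦ legendreIntegral (-1 / 2) (1 - m) * legendreIntegral (1 / 2) m +
      legendreIntegral (1 / 2) (1 - m) * legendreIntegral (-1 / 2) m -
      legendreIntegral (-1 / 2) (1 - m) * legendreIntegral (-1 / 2) m with hW
  have hderiv : ∀ x ∈ Ioo (0:ℝ) 1, HasDerivAt W 0 x := by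
    intro x ⟨hx0, hx1⟩
    have hE := hasDerivAt_legendreIntegral_half hx0 hx1
    have hK := hasDerivAt_legendreIntegral_neg_half hx0 hx1
    have hE' := hasDerivAt_legendreIntegral_half_one_sub hx0 hx1
    have hK' := hasDerivAt_legendreIntegral_neg_half_one_sub hx0 hx1
    refine (((hK'.mul hE).add (hE'.mul hK)).sub (hK'.mul hK)).congr_deriv ?_
    have h1 : 1 - x ≠ 0 := by linarith
    field_simp
    ring
  obtain ⟨a, ha⟩ := isOpen_Ioo.exists_is_const_of_deriv_eq_zero isPreconnected_Ioo
    (fun x hx ↦ (hderiv x hx).differentiableAt.differentiableWithinAt)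
    (fun x hx ↦ (hderiv x hx).deriv)
  have hlim : Tendsto W (𝓝[>] 0) (𝓝 (π / 2)) := by
    obtain ⟨c, hc⟩ := exists_tendsto_legendreIntegral_slope (1 / 2)
    obtain ⟨d, hd⟩ := exists_tendsto_legendreIntegral_slope (-1 / 2)
    have hid : Tendsto (fun m : ℝ ↦ m) (𝓝[>] 0) (𝓝 0) :=
      tendsto_nhdsWithin_of_tendsto_nhds tendsto_id
    have h := ((((tendsto_legendreIntegral_neg_half_add_log.mul hid).sub
      (tendsto_mul_log_nhdsGT_zero.div_const 2)).mul (hc.sub hd))).add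
      (tendsto_legendreIntegral_half_one_sub.mul (tendsto_legendreIntegral_nhdsGT_zero (-1 / 2)))
    have hval : (2 * log 2 * 0 - 0 / 2) * (c - d) + 1 * (π / 2) = π / 2 := by ring
    rw [hval] at h
    refine h.congr' ?_
    filter_upwards [self_mem_nhdsWithin] with x (hx : 0 < x)
    simp only [hW]
    field_simp
    ring
  have hconst : Tendsto W (𝓝[>] 0) (𝓝 a) := by
    refine tendsto_const_nhds.congr' ?_
    filter_upwards [Ioo_mem_nhdsGT zero_lt_one] with x hx
    exact (ha x hx).symm
  have hm : m ∈ Ioo (0:ℝ) 1 := ⟨hm0, hm1⟩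
  exact (ha m hm).trans (tendsto_nhds_unique hconst hlim)

lemma legendreIntegral_pos (p : ℝ) {m : ℝ} (hm : m < 1) : 0 < legendreIntegral p m :=
  intervalIntegral.intervalIntegral_pos_of_pos
    ((continuous_one_sub_mul_sin_sq_rpow hm p).intervalIntegrable _ _)
    (fun θ ↦ rpow_pos_of_pos (one_sub_mul_sin_sq_pos hm θ) p) (by positivity)

lemma legendreIntegral_le {p m : ℝ} (hp : 0 ≤ p) (hm0 : 0 ≤ m) (hm : m < 1) :
    legendreIntegral p m ≤ π / 2 := by
  rw [← legendreIntegral_zero p]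
  refine intervalIntegral.integral_mono_on (by positivity)
    ((continuous_one_sub_mul_sin_sq_rpow hm p).intervalIntegrable _ _)
    ((continuous_one_sub_mul_sin_sq_rpow one_pos p).intervalIntegrable _ _) fun θ _ ↦ ?_
  refine rpow_le_rpow (one_sub_mul_sin_sq_pos hm θ).le ?_ hp
  nlinarith [mul_nonneg hm0 (sq_nonneg (sin θ))]

lemma ellE_eq_legendreIntegral {k : ℝ} (hk : k ^ 2 < 1) :
    ellE k = legendreIntegral (1 / 2) (k ^ 2) := by
  have himage : sin '' Ioo 0 (π / 2) = Ioo 0 1 := by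
    ext y
    constructor
    · rintro ⟨θ, hθ, rfl⟩
      refine ⟨sin_pos_of_pos_of_lt_pi hθ.1 (by linarith [hθ.2, pi_pos]), ?_⟩
      rw [← sin_pi_div_two]
      exact sin_lt_sin_of_lt_of_le_pi_div_two (by linarith [hθ.1, pi_pos]) le_rfl hθ.2
    · intro hy
      exact ⟨arcsin y, ⟨arcsin_pos.2 hy.1, arcsin_lt_pi_div_two.2 hy.2⟩,
        sin_arcsin (by linarith [hy.1]) hy.2.le⟩
  have hinj : InjOn sin (Ioo 0 (π / 2)) :=
    injOn_sin.mono fun θ (hθ : θ ∈ Ioo 0 (π / 2)) ↦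
      show θ ∈ Icc _ _ from ⟨by linarith [hθ.1, pi_pos], hθ.2.le⟩
  rw [ellE, legendreIntegral, intervalIntegral.integral_of_le zero_le_one,
    intervalIntegral.integral_of_le (by positivity), integral_Ioc_eq_integral_Ioo,
    integral_Ioc_eq_integral_Ioo, ← himage, integral_image_eq_integral_abs_deriv_smul
      measurableSet_Ioo (fun θ _ ↦ (hasDerivAt_sin θ).hasDerivWithinAt) hinj]
  refine setIntegral_congr_fun measurableSet_Ioo fun θ hθ ↦ ?_
  have hc : 0 < cos θ := cos_pos_of_mem_Ioo ⟨by linarith [hθ.1, pi_pos], hθ.2⟩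
  have hpos := one_sub_mul_sin_sq_pos hk θ
  simp only [smul_eq_mul]
  rw [abs_of_pos hc, ← cos_sq', sqrt_div hpos.le, sqrt_sq hc.le, ← sqrt_eq_rpow]
  field_simp

/-- A primitive of `(1 - (π / 2)² / E²) / (2 m)`, where `E` is the complete elliptic integral of the
second kind with parameter `m`. -/
noncomputable def legendrePrimitive (m : ℝ) : ℝ :=
  π / 2 * (legendreIntegral (-1 / 2) (1 - m) - legendreIntegral (1 / 2) (1 - m)) /
    legendreIntegral (1 / 2) m + log m / 2

lemma hasDerivAt_legendrePrimitive {m : ℝ} (hm0 : 0 < m) (hm1 : m < 1) :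
    HasDerivAt legendrePrimitive
      ((1 - (π / 2) ^ 2 / legendreIntegral (1 / 2) m ^ 2) / (2 * m)) m := by
  have hpos := legendreIntegral_pos (1 / 2) hm1
  have hE := hasDerivAt_legendreIntegral_half hm0 hm1
  have hE' := hasDerivAt_legendreIntegral_half_one_sub hm0 hm1
  have hK' := hasDerivAt_legendreIntegral_neg_half_one_sub hm0 hm1
  refine ((((hK'.sub hE').const_mul (π / 2)).div hE hpos.ne').add
    ((hasDerivAt_log hm0.ne').div_const 2)).congr_deriv ?_
  have h1 : 1 - m ≠ 0 := by linarith
  have hL := legendre_relation hm0 hm1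
  simp only [Pi.sub_apply]
  generalize legendreIntegral (-1 / 2) (1 - m) = K' at *
  generalize legendreIntegral (1 / 2) (1 - m) = E' at *
  generalize legendreIntegral (-1 / 2) m = K at *
  generalize legendreIntegral (1 / 2) m = E at *
  field_simp
  linear_combination (-(1 - m) * π * 2) * hL

lemma tendsto_legendrePrimitive_nhdsGT_zero :
    Tendsto legendrePrimitive (𝓝[>] 0) (𝓝 (2 * log 2 - 1)) := by
  obtain ⟨c, hc⟩ := exists_tendsto_legendreIntegral_slope (1 / 2)
  have hE := tendsto_legendreIntegral_nhdsGT_zero (1 / 2)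
  have hpi : π / 2 ≠ 0 := by positivity
  have h := (((tendsto_legendreIntegral_neg_half_add_log.sub
    tendsto_legendreIntegral_half_one_sub).const_mul (π / 2)).div hE hpi).add
    ((tendsto_mul_log_nhdsGT_zero.div_const 2).mul (hc.div hE hpi))
  have hval : π / 2 * (2 * log 2 - 1) / (π / 2) + 0 / 2 * (c / (π / 2)) = 2 * log 2 - 1 := by
    field_simp
    ring
  rw [hval] at h
  refine h.congr' ?_
  filter_upwards [Ioo_mem_nhdsGT zero_lt_one] with m ⟨hm0, hm1⟩
  have hpos := legendreIntegral_pos (1 / 2) hm1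
  simp only [legendrePrimitive, Pi.div_apply]
  field_simp
  ring

lemma tendsto_legendrePrimitive_nhdsLT_one :
    Tendsto legendrePrimitive (𝓝[<] 1) (𝓝 0) := by
  have hc : ∀ p, ContinuousAt (fun m : ℝ ↦ legendreIntegral p (1 - m)) 1 := fun p ↦
    ContinuousAt.comp (g := legendreIntegral p)
      (continuousAt_legendreIntegral p (by norm_num)) (by fun_prop)
  have h : ContinuousAt legendrePrimitive 1 := by
    refine ((((hc _).sub (hc _)).const_mul (π / 2)).div
      (continuous_legendreIntegral (by norm_num)).continuousAt ?_).add
      ((continuousAt_log one_ne_zero).div_const 2)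
    rw [legendreIntegral_half_one]
    exact one_ne_zero
  have h1 := tendsto_nhdsWithin_of_tendsto_nhds (s := Iio 1) h.tendsto
  simpa [legendrePrimitive, legendreIntegral_zero] using h1

theorem stmt8 :
    MeasureTheory.IntegrableOn
      (fun t => (Real.pi^2/4 - (ellE t)^2) / (t * (ellE t)^2)) (Set.Ioc 0 1)
      MeasureTheory.volume ∧
    ∫ t in Set.Ioc (0:ℝ) 1, (Real.pi^2/4 - (ellE t)^2) / (t * (ellE t)^2) =
      2 * Real.log 2 - 1 := by
  have hsq : ∀ {t : ℝ}, t ∈ Ioo (0:ℝ) 1 → 0 < t ^ 2 ∧ t ^ 2 < 1 := fun {t} ht ↦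
    ⟨pow_pos ht.1 2, by nlinarith [ht.1, ht.2]⟩
  have hderiv : ∀ t ∈ Ioo (0:ℝ) 1, HasDerivAt (fun t ↦ -legendrePrimitive (t ^ 2))
      ((π ^ 2 / 4 - ellE t ^ 2) / (t * ellE t ^ 2)) t := by
    intro t ht
    obtain ⟨h0, h1⟩ := hsq ht
    have ht0 : t ≠ 0 := ht.1.ne'
    refine (HasDerivAt.comp (h := fun t : ℝ ↦ t ^ 2) t (hasDerivAt_legendrePrimitive h0 h1)
      (hasDerivAt_pow 2 t)).neg.congr_deriv ?_
    have hpos := legendreIntegral_pos (1 / 2) h1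
    rw [ellE_eq_legendreIntegral h1]
    field_simp
    ring
  have hnonneg : ∀ t ∈ Ioo (0:ℝ) 1, 0 ≤ (π ^ 2 / 4 - ellE t ^ 2) / (t * ellE t ^ 2) := by
    intro t ht
    obtain ⟨h0, h1⟩ := hsq ht
    have hpos := legendreIntegral_pos (1 / 2) h1
    have hle := legendreIntegral_le (p := 1 / 2) (by norm_num) h0.le h1
    rw [ellE_eq_legendreIntegral h1]
    refine div_nonneg ?_ (mul_nonneg ht.1.le (sq_nonneg _))
    nlinarith
  have hzero : Tendsto (fun t : ℝ ↦ -legendrePrimitive (t ^ 2)) (𝓝[>] 0)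
      (𝓝 (-(2 * log 2 - 1))) := by
    refine (tendsto_legendrePrimitive_nhdsGT_zero.comp
      (tendsto_nhdsWithin_iff.2 ⟨?_, ?_⟩)).neg
    · simpa using tendsto_nhdsWithin_of_tendsto_nhds (s := Ioi (0:ℝ)) ((continuous_pow 2).tendsto 0)
    · filter_upwards [self_mem_nhdsWithin] with t (ht : 0 < t)
      exact pow_pos ht 2
  have hone : Tendsto (fun t : ℝ ↦ -legendrePrimitive (t ^ 2)) (𝓝[<] 1) (𝓝 (-0)) := by
    refine (tendsto_legendrePrimitive_nhdsLT_one.comp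
      (tendsto_nhdsWithin_iff.2 ⟨?_, ?_⟩)).neg
    · simpa using tendsto_nhdsWithin_of_tendsto_nhds (s := Iio (1:ℝ)) ((continuous_pow 2).tendsto 1)
    · filter_upwards [Ioo_mem_nhdsLT zero_lt_one] with t ht
      exact (hsq ht).2
  have h_int : IntegrableOn (fun t ↦ (π ^ 2 / 4 - ellE t ^ 2) / (t * ellE t ^ 2)) (Ioc 0 1) := by
    have hcont : ContinuousOn (fun t ↦ -legendrePrimitive (t ^ 2)) (Ioo 0 1) :=
      fun t ht ↦ (hderiv t ht).continuousAt.continuousWithinAt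
    refine intervalIntegral.integrableOn_deriv_of_nonneg
      (continuousOn_Icc_extendFrom_Ioo hcont hzero hone) (fun t ht ↦ ?_) hnonneg
    refine (hderiv t ht).congr_of_eventuallyEq ?_
    filter_upwards [isOpen_Ioo.mem_nhds ht] with s hs
    exact extendFrom_extends hcont s hs
  refine ⟨h_int, ?_⟩
  rw [← intervalIntegral.integral_of_le zero_le_one,
    intervalIntegral.integral_eq_sub_of_hasDerivAt_of_tendsto zero_lt_one hderiv
      ((intervalIntegrable_iff_integrableOn_Ioc_of_le zero_le_one).2 h_int) hzero hone]
  ring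
end

section
/- For every real x with 0 ≤ x < 1, one has E(x) − 1 ≤ (1 − x²) · K(x). -/
open MeasureTheory

theorem intervalIntegrable_one_div_sqrt_one_sub_sq :
    IntervalIntegrable (fun t : ℝ => 1 / Real.sqrt (1 - t ^ 2)) volume 0 1 := by
  apply intervalIntegral.intervalIntegrable_deriv_of_nonneg (g := Real.arcsin)
    Real.continuous_arcsin.continuousOn
  · intro t ht
    rw [min_eq_left zero_le_one, max_eq_right zero_le_one] at ht
    exact Real.hasDerivAt_arcsin (by linarith [ht.1]) ht.2.ne
  · intro t _
    positivity

theorem one_sub_sq_mul_sq_pos {k t : ℝ} (hk : 0 ≤ k) (hk1 : k < 1) (ht : 0 ≤ t) (ht1 : t ≤ 1) :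
    0 < 1 - k ^ 2 * t ^ 2 := by
  nlinarith [mul_nonneg hk ht, mul_le_of_le_one_right hk ht1]

theorem intervalIntegrable_ellK_integrand {k : ℝ} (hk : 0 ≤ k) (hk1 : k < 1) :
    IntervalIntegrable (fun t : ℝ => 1 / Real.sqrt ((1 - t ^ 2) * (1 - k ^ 2 * t ^ 2)))
      volume 0 1 := by
  have hcont : ContinuousOn (fun t : ℝ => 1 / Real.sqrt (1 - k ^ 2 * t ^ 2)) (Set.uIcc 0 1) := by
    apply ContinuousOn.div continuousOn_const (by fun_prop)
    intro t ht
    rw [Set.uIcc_of_le zero_le_one] at ht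
    exact (Real.sqrt_pos.2 (one_sub_sq_mul_sq_pos hk hk1 ht.1 ht.2)).ne'
  refine (intervalIntegrable_one_div_sqrt_one_sub_sq.mul_continuousOn hcont).congr ?_
  intro t ht
  rw [Set.uIoc_of_le zero_le_one] at ht
  simp only [Real.sqrt_mul (show 0 ≤ 1 - t ^ 2 by nlinarith [ht.1, ht.2])]
  ring

/-- The integrand of `ellE k` is at most `1` plus `1 - k ^ 2` times that of `ellK k`. -/
theorem ellE_integrand_le {k t : ℝ} (hk : 0 ≤ k) (hk1 : k < 1) (ht : 0 ≤ t) (ht1 : t < 1) :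
    Real.sqrt ((1 - k ^ 2 * t ^ 2) / (1 - t ^ 2)) ≤
      1 + (1 - k ^ 2) * (1 / Real.sqrt ((1 - t ^ 2) * (1 - k ^ 2 * t ^ 2))) := by
  have hb := one_sub_sq_mul_sq_pos hk hk1 ht ht1.le
  have ha : 0 < 1 - t ^ 2 := by nlinarith
  have hab : 1 - t ^ 2 ≤ 1 - k ^ 2 * t ^ 2 := by
    nlinarith [mul_nonneg (show 0 ≤ 1 - k ^ 2 by nlinarith) (sq_nonneg t)]
  rw [Real.sqrt_div hb.le, Real.sqrt_mul ha.le]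
  have hA := Real.sqrt_pos.2 ha
  have hB := Real.sqrt_pos.2 hb
  have hAB := Real.sqrt_le_sqrt hab
  have hA2 := Real.sq_sqrt ha.le
  have hB2 := Real.sq_sqrt hb.le
  set A := Real.sqrt (1 - t ^ 2)
  set B := Real.sqrt (1 - k ^ 2 * t ^ 2)
  have hnum : B ^ 2 ≤ A * B + (1 - k ^ 2) := by
    have h : k ^ 2 * A ^ 2 ≤ A * B := by
      have h1 : k ^ 2 * A ^ 2 ≤ A ^ 2 := by
        nlinarith [mul_nonneg (show 0 ≤ 1 - k ^ 2 by nlinarith) (sq_nonneg A)]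
      nlinarith
    rw [hA2] at h
    linarith
  calc B / A = B ^ 2 / (A * B) := by field_simp
    _ ≤ (A * B + (1 - k ^ 2)) / (A * B) := by gcongr
    _ = 1 + (1 - k ^ 2) * (1 / (A * B)) := by field_simp

theorem stmt11 (x : ℝ) (hx : 0 ≤ x) (hx1 : x < 1) :
    ellE x - 1 ≤ (1 - x^2) * ellK x := by
  have hK := (intervalIntegrable_ellK_integrand hx hx1).const_mul (1 - x ^ 2)
  have hsum : ∫ t in (0:ℝ)..1,
      (1 + (1 - x ^ 2) * (1 / Real.sqrt ((1 - t ^ 2) * (1 - x ^ 2 * t ^ 2)))) =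
        1 + (1 - x ^ 2) * ellK x := by
    rw [intervalIntegral.integral_add intervalIntegrable_const hK,
      intervalIntegral.integral_const_mul, ellK]
    simp
  rw [sub_le_iff_le_add', ← hsum, ellE]
  have hx2 : 0 ≤ 1 - x ^ 2 := by nlinarith
  by_cases hE : IntervalIntegrable
      (fun t : ℝ => Real.sqrt ((1 - x ^ 2 * t ^ 2) / (1 - t ^ 2))) volume 0 1
  · exact intervalIntegral.integral_mono_on_of_le_Ioo zero_le_one hE
      (intervalIntegrable_const.add hK)
      fun t ht => ellE_integrand_le hx hx1 ht.1.le ht.2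
  · rw [intervalIntegral.integral_undef hE]
    exact intervalIntegral.integral_nonneg zero_le_one fun t _ => by positivity
end

section
/- For every real x with 0 < x < 1, the function Φ is differentiable at x with derivative Φ'(x) = E(Φ(x))²/K(Φ(x)), and 0 ≤ Φ'(x) ≤ E(0)²/K(0) = π/2. -/
open MeasureTheory

section EllipticIntegrals

open Real Set

theorem Real.sin_image_Ioo_zero_pi_div_two : sin '' Ioo 0 (π / 2) = Ioo (0 : ℝ) 1 := by
  ext y
  constructor
  · rintro ⟨θ, ⟨h0, h1⟩, rfl⟩
    refine ⟨sin_pos_of_pos_of_lt_pi h0 (by linarith [pi_pos]), ?_⟩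
    have h := sin_lt_sin_of_lt_of_le_pi_div_two (by linarith) le_rfl h1
    rwa [sin_pi_div_two] at h
  · rintro ⟨h0, h1⟩
    exact ⟨arcsin y, ⟨arcsin_pos.2 h0, arcsin_lt_pi_div_two.2 h1⟩,
      sin_arcsin (by linarith) h1.le⟩

theorem integral_zero_one_eq_integral_comp_sin (g : ℝ → ℝ) :
    ∫ t in (0 : ℝ)..1, g t = ∫ θ in (0 : ℝ)..(π / 2), cos θ * g (sin θ) := by
  have hpi := pi_pos
  have hinj : InjOn sin (Ioo 0 (π / 2)) :=
    injOn_sin.mono (Ioo_subset_Icc_self.trans (Icc_subset_Icc_left (by linarith)))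
  rw [intervalIntegral.integral_of_le zero_le_one, intervalIntegral.integral_of_le (by positivity),
    integral_Ioc_eq_integral_Ioo, integral_Ioc_eq_integral_Ioo,
    ← Real.sin_image_Ioo_zero_pi_div_two,
    integral_image_eq_integral_abs_deriv_smul measurableSet_Ioo
      (fun θ _ => (hasDerivAt_sin θ).hasDerivWithinAt) hinj]
  refine setIntegral_congr_fun measurableSet_Ioo fun θ hθ => ?_
  simp only [smul_eq_mul]
  rw [abs_of_pos (cos_pos_of_mem_Ioo ⟨by linarith [hθ.1], hθ.2⟩)]

theorem ellE_eq_integral_sin (k : ℝ) :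
    ellE k = ∫ θ in (0 : ℝ)..(π / 2), √(1 - k ^ 2 * sin θ ^ 2) := by
  have hpi := pi_pos
  rw [ellE, integral_zero_one_eq_integral_comp_sin]
  refine intervalIntegral.integral_congr_Ioo_of_le (by positivity) fun θ hθ => ?_
  have hc : 0 < cos θ := cos_pos_of_mem_Ioo ⟨by linarith [hθ.1], hθ.2⟩
  rw [← cos_sq', sqrt_div' _ (sq_nonneg _), sqrt_sq hc.le]
  field_simp

theorem ellK_eq_integral_sin (k : ℝ) :
    ellK k = ∫ θ in (0 : ℝ)..(π / 2), 1 / √(1 - k ^ 2 * sin θ ^ 2) := by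
  have hpi := pi_pos
  rw [ellK, integral_zero_one_eq_integral_comp_sin]
  refine intervalIntegral.integral_congr_Ioo_of_le (by positivity) fun θ hθ => ?_
  have hc : 0 < cos θ := cos_pos_of_mem_Ioo ⟨by linarith [hθ.1], hθ.2⟩
  rw [← cos_sq', sqrt_mul (sq_nonneg _), sqrt_sq hc.le, mul_one_div, div_mul_cancel_left₀ hc.ne',
    one_div]

theorem ellE_zero : ellE 0 = π / 2 := by
  simp [ellE_eq_integral_sin]

theorem ellK_zero : ellK 0 = π / 2 := by
  simp [ellK_eq_integral_sin]

theorem ellE_one : ellE 1 = 1 := by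
  have hpi := pi_pos
  have h : EqOn (fun θ => √(1 - 1 ^ 2 * sin θ ^ 2)) cos (Ioo 0 (π / 2)) := fun θ hθ => by
    simp only [one_pow, one_mul]
    rw [← abs_cos_eq_sqrt_one_sub_sin_sq,
      abs_of_pos (cos_pos_of_mem_Ioo ⟨by linarith [hθ.1], hθ.2⟩)]
  rw [ellE_eq_integral_sin, intervalIntegral.integral_congr_Ioo_of_le (by positivity) h]
  simp

theorem continuous_ellE : Continuous ellE := by
  rw [funext ellE_eq_integral_sin]
  exact intervalIntegral.continuous_parametric_intervalIntegral_of_continuous' (by fun_prop) _ _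

theorem antitoneOn_ellE : AntitoneOn ellE (Ici 0) := by
  intro a ha b _ hab
  rw [ellE_eq_integral_sin, ellE_eq_integral_sin]
  refine intervalIntegral.integral_mono_on (by positivity)
    (Continuous.intervalIntegrable (by fun_prop) _ _)
    (Continuous.intervalIntegrable (by fun_prop) _ _) fun θ _ => ?_
  have ha' : 0 ≤ a := ha
  gcongr

theorem one_le_ellE {k : ℝ} (hk : k ∈ Icc (0 : ℝ) 1) : 1 ≤ ellE k := by
  simpa [ellE_one] using antitoneOn_ellE hk.1 (mem_Ici.2 zero_le_one) hk.2

theorem ellE_le_pi_div_two {k : ℝ} (hk : 0 ≤ k) : ellE k ≤ π / 2 := by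
  simpa [ellE_zero] using antitoneOn_ellE (mem_Ici.2 le_rfl) hk hk

theorem one_sub_sq_mul_sin_sq_pos {k : ℝ} (hk : k ∈ Ico (0 : ℝ) 1) (θ : ℝ) :
    0 < 1 - k ^ 2 * sin θ ^ 2 := by
  have h1 : k ^ 2 < 1 := by nlinarith [hk.1, hk.2]
  nlinarith [sin_sq_le_one θ, sq_nonneg k, sq_nonneg (sin θ)]

theorem continuous_one_div_sqrt_one_sub_sq_mul_sin_sq {k : ℝ} (hk : k ∈ Ico (0 : ℝ) 1) :
    Continuous fun θ : ℝ => 1 / √(1 - k ^ 2 * sin θ ^ 2) :=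
  continuous_const.div (by fun_prop) fun θ => (sqrt_pos.2 (one_sub_sq_mul_sin_sq_pos hk θ)).ne'

theorem pi_div_two_le_ellK {k : ℝ} (hk : k ∈ Ico (0 : ℝ) 1) : π / 2 ≤ ellK k := by
  rw [← ellK_zero, ellK_eq_integral_sin, ellK_eq_integral_sin]
  refine intervalIntegral.integral_mono_on (by positivity)
    ((continuous_one_div_sqrt_one_sub_sq_mul_sin_sq ⟨le_rfl, zero_lt_one⟩).intervalIntegrable _ _)
    ((continuous_one_div_sqrt_one_sub_sq_mul_sin_sq hk).intervalIntegrable _ _) fun θ _ => ?_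
  have hpos := sqrt_pos.2 (one_sub_sq_mul_sin_sq_pos hk θ)
  gcongr
  simpa using hk.1

theorem hasDerivAt_ellE {k : ℝ} (hk : k ∈ Ioo (0 : ℝ) 1) :
    HasDerivAt ellE (∫ θ in (0 : ℝ)..(π / 2), -(k * sin θ ^ 2) / √(1 - k ^ 2 * sin θ ^ 2)) k := by
  obtain ⟨r, hkr, hr1⟩ := exists_between hk.2
  have hr : r ∈ Ico (0 : ℝ) 1 := ⟨(hk.1.trans hkr).le, hr1⟩
  rw [funext ellE_eq_integral_sin]
  refine (intervalIntegral.hasDerivAt_integral_of_dominated_loc_of_deriv_le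
    (F := fun y θ => √(1 - y ^ 2 * sin θ ^ 2))
    (F' := fun y θ => -(y * sin θ ^ 2) / √(1 - y ^ 2 * sin θ ^ 2))
    (bound := fun θ => 1 / √(1 - r ^ 2 * sin θ ^ 2)) (Ioo_mem_nhds hk.1 hkr)
    (.of_forall fun y => Continuous.aestronglyMeasurable (by fun_prop))
    (Continuous.intervalIntegrable (by fun_prop) _ _)
    (Measurable.aestronglyMeasurable (by fun_prop)) (.of_forall fun θ _ y hy => ?_)
    ((continuous_one_div_sqrt_one_sub_sq_mul_sin_sq hr).intervalIntegrable _ _)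
    (.of_forall fun θ _ y hy => ?_)).2
  · have hy1 : y ∈ Ico (0 : ℝ) 1 := ⟨hy.1.le, hy.2.trans hr1⟩
    have hpos := sqrt_pos.2 (one_sub_sq_mul_sin_sq_pos hr θ)
    have hy0 := hy.1.le
    rw [norm_div, norm_neg, norm_of_nonneg (mul_nonneg hy0 (sq_nonneg _)),
      norm_of_nonneg (sqrt_nonneg _)]
    gcongr
    · exact mul_le_one₀ hy1.2.le (sq_nonneg _) (sin_sq_le_one θ)
    · exact hy.2.le
  · have hpos := one_sub_sq_mul_sin_sq_pos ⟨hy.1.le, hy.2.trans hr1⟩ θ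
    have hsqrt := (sqrt_pos.2 hpos).ne'
    refine ((((hasDerivAt_pow 2 y).mul_const (sin θ ^ 2)).const_sub 1).sqrt hpos.ne').congr_deriv ?_
    norm_num
    field_simp

theorem ellE_sub_mul_deriv_eq_ellK {k : ℝ} (hk : k ∈ Ico (0 : ℝ) 1) :
    ellE k - k * ∫ θ in (0 : ℝ)..(π / 2), -(k * sin θ ^ 2) / √(1 - k ^ 2 * sin θ ^ 2) =
      ellK k := by
  have hpos := fun θ => one_sub_sq_mul_sin_sq_pos hk θ
  rw [ellE_eq_integral_sin, ellK_eq_integral_sin, ← intervalIntegral.integral_const_mul,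
    ← intervalIntegral.integral_sub]
  · refine intervalIntegral.integral_congr fun θ _ => ?_
    have h := (sqrt_pos.2 (hpos θ)).ne'
    have h2 := sq_sqrt (hpos θ).le
    field_simp
    rw [h2]
    ring
  · exact Continuous.intervalIntegrable (by fun_prop) _ _
  · refine (continuous_const.mul (Continuous.div (by fun_prop) (by fun_prop) fun θ =>
      (sqrt_pos.2 (hpos θ)).ne')).intervalIntegrable _ _

theorem hasDerivAt_PsiFn {k : ℝ} (hk : k ∈ Ioo (0 : ℝ) 1) :
    HasDerivAt PsiFn (ellK k / ellE k ^ 2) k := by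
  have hE : ellE k ≠ 0 := (zero_lt_one.trans_le (one_le_ellE (Ioo_subset_Icc_self hk))).ne'
  have h := (hasDerivAt_id k).div (hasDerivAt_ellE hk) hE
  simp only [id, one_mul, ellE_sub_mul_deriv_eq_ellK (Ioo_subset_Ico_self hk)] at h
  exact h

theorem strictMonoOn_PsiFn : StrictMonoOn PsiFn (Icc 0 1) := by
  intro a ha b hb hab
  have hEb : 0 < ellE b := zero_lt_one.trans_le (one_le_ellE hb)
  exact div_lt_div₀ hab (antitoneOn_ellE ha.1 hb.1 hab.le) hb.1 hEb

theorem continuousOn_PsiFn : ContinuousOn PsiFn (Icc 0 1) :=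
  continuousOn_id.div continuous_ellE.continuousOn fun _ hk =>
    (zero_lt_one.trans_le (one_le_ellE hk)).ne'

theorem PhiFn_PsiFn {k : ℝ} (hk : k ∈ Icc (0 : ℝ) 1) : PhiFn (PsiFn k) = k := by
  refine IsGreatest.csSup_eq ⟨⟨hk, le_rfl⟩, fun y hy => ?_⟩
  exact (strictMonoOn_PsiFn.le_iff_le hy.1 hk).1 hy.2

theorem exists_PsiFn_eq {x : ℝ} (hx : x ∈ Ioo (0 : ℝ) 1) : ∃ k ∈ Ioo (0 : ℝ) 1, PsiFn k = x := by
  have h := intermediate_value_Ioo zero_le_one continuousOn_PsiFn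
  rw [show PsiFn 0 = 0 by simp [PsiFn], show PsiFn 1 = 1 by simp [PsiFn, ellE_one]] at h
  exact h hx

theorem PsiFn_mem_Ioo {k : ℝ} (hk : k ∈ Ioo (0 : ℝ) 1) : PsiFn k ∈ Ioo (0 : ℝ) 1 := by
  have h0 := strictMonoOn_PsiFn ⟨le_rfl, zero_le_one⟩ (Ioo_subset_Icc_self hk) hk.1
  have h1 := strictMonoOn_PsiFn (Ioo_subset_Icc_self hk) ⟨zero_le_one, le_rfl⟩ hk.2
  simp only [PsiFn, zero_div, ellE_one, div_one] at h0 h1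
  exact ⟨h0, h1⟩

theorem PhiFn_mem_Ioo {x : ℝ} (hx : x ∈ Ioo (0 : ℝ) 1) : PhiFn x ∈ Ioo (0 : ℝ) 1 := by
  obtain ⟨k, hk, rfl⟩ := exists_PsiFn_eq hx
  rwa [PhiFn_PsiFn (Ioo_subset_Icc_self hk)]

theorem PsiFn_PhiFn {x : ℝ} (hx : x ∈ Ioo (0 : ℝ) 1) : PsiFn (PhiFn x) = x := by
  obtain ⟨k, hk, rfl⟩ := exists_PsiFn_eq hx
  rw [PhiFn_PsiFn (Ioo_subset_Icc_self hk)]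

theorem strictMonoOn_PhiFn : StrictMonoOn PhiFn (Ioo 0 1) := by
  intro a ha b hb hab
  rw [← PsiFn_PhiFn ha, ← PsiFn_PhiFn hb] at hab
  exact (strictMonoOn_PsiFn.lt_iff_lt (Ioo_subset_Icc_self (PhiFn_mem_Ioo ha))
    (Ioo_subset_Icc_self (PhiFn_mem_Ioo hb))).1 hab

theorem continuousAt_PhiFn {x : ℝ} (hx : x ∈ Ioo (0 : ℝ) 1) : ContinuousAt PhiFn x := by
  refine strictMonoOn_PhiFn.continuousAt_of_image_mem_nhds (isOpen_Ioo.mem_nhds hx)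
    (Filter.mem_of_superset (isOpen_Ioo.mem_nhds (PhiFn_mem_Ioo hx)) fun k hk => ?_)
  exact ⟨PsiFn k, PsiFn_mem_Ioo hk, PhiFn_PsiFn (Ioo_subset_Icc_self hk)⟩

theorem hasDerivAt_PhiFn {x : ℝ} (hx : x ∈ Ioo (0 : ℝ) 1) :
    HasDerivAt PhiFn (ellE (PhiFn x) ^ 2 / ellK (PhiFn x)) x := by
  have hk := PhiFn_mem_Ioo hx
  have hE := zero_lt_one.trans_le (one_le_ellE (Ioo_subset_Icc_self hk))
  have hK := (half_pos pi_pos).trans_le (pi_div_two_le_ellK (Ioo_subset_Ico_self hk))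
  rw [← inv_div]
  exact (hasDerivAt_PsiFn hk).of_local_left_inverse (continuousAt_PhiFn hx) (by positivity)
    (Filter.eventually_of_mem (isOpen_Ioo.mem_nhds hx) fun y hy => PsiFn_PhiFn hy)

theorem ellE_sq_div_ellK_le {k : ℝ} (hk : k ∈ Ico (0 : ℝ) 1) :
    ellE k ^ 2 / ellK k ≤ π / 2 := by
  have hpi := pi_pos
  have hE := one_le_ellE (Ico_subset_Icc_self hk)
  have hE' := ellE_le_pi_div_two hk.1
  have hK := pi_div_two_le_ellK hk
  rw [div_le_iff₀ (by linarith)]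
  calc ellE k ^ 2 ≤ (π / 2) ^ 2 := by gcongr
    _ = π / 2 * (π / 2) := sq _
    _ ≤ π / 2 * ellK k := by gcongr

end EllipticIntegrals

theorem stmt14 (x : ℝ) (hx : 0 < x) (hx1 : x < 1) :
    HasDerivAt PhiFn ((ellE (PhiFn x))^2 / ellK (PhiFn x)) x ∧
    0 ≤ (ellE (PhiFn x))^2 / ellK (PhiFn x) ∧
    (ellE (PhiFn x))^2 / ellK (PhiFn x) ≤ Real.pi / 2 ∧
    (ellE 0)^2 / ellK 0 = Real.pi / 2 := by
  have hk := PhiFn_mem_Ioo ⟨hx, hx1⟩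
  have hK := (half_pos Real.pi_pos).trans_le (pi_div_two_le_ellK (Set.Ioo_subset_Ico_self hk))
  refine ⟨hasDerivAt_PhiFn ⟨hx, hx1⟩, by positivity,
    ellE_sq_div_ellK_le (Set.Ioo_subset_Ico_self hk), ?_⟩
  have hpi := Real.pi_pos
  rw [ellE_zero, ellK_zero]
  field_simp
end
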